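/- arXiv:1902.08406 — 2 statements merged into one kernel-verified Lean document; each statement's English description precedes it below -/
import Mathlib

section
/- Let A* be a Poincaré DGCA of degree n of Hodge type. Then the canonical projection π : A* → Q* := A*/A*⊥ is a quasi-isomorphism of DGCAs, and the pairing induced on Q* by ⟨π(a), π(b)⟩_Q = ⟨a, b⟩ is well-defined and nondegenerate. In particular, every Poincaré DGCA of Hodge type is equivalent to a nondegenerate Poincaré DGCA of the same degree. -/
universe u v

open scoped TensorProduct

/-- A (not necessarily commutative) differential graded algebra over `F`:
a nonnegatively graded, associative, unital `F`-algebra equipped with a degree `+1`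
differential `d` satisfying `d ∘ d = 0` and the graded Leibniz rule. -/
structure DGA (F : Type u) (A : Type v) [Field F] [Ring A] [Algebra F A] where
  grading : ℤ → Submodule F A
  internal : DirectSum.IsInternal grading
  nonneg : ∀ i : ℤ, i < 0 → grading i = ⊥
  one_mem : (1 : A) ∈ grading 0
  mul_mem : ∀ {i j : ℤ} {a b : A}, a ∈ grading i → b ∈ grading j → a * b ∈ grading (i + j)
  d : A →ₗ[F] A
  d_mem : ∀ {i : ℤ} {a : A}, a ∈ grading i → d a ∈ grading (i + 1)
  d_d : ∀ a : A, d (d a) = 0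
  leibniz : ∀ {i : ℤ} (a b : A), a ∈ grading i →
    d (a * b) = d a * b + ((-1 : F) ^ i) • (a * d b)

namespace DGA

variable {F : Type u} {A : Type v} [Field F] [Ring A] [Algebra F A]

/-- The cocycles of degree `k`. -/
def Zc (D : DGA F A) (k : ℤ) : Submodule F A := D.grading k ⊓ LinearMap.ker D.d

/-- The coboundaries of degree `k`. -/
def Bc (D : DGA F A) (k : ℤ) : Submodule F A := Submodule.map D.d (D.grading (k - 1))

/-- `a` is exact, i.e. a coboundary. -/
def IsExact (D : DGA F A) (a : A) : Prop := ∃ b, a = D.d b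

/-- Two elements define the same cohomology class. -/
def Cohomologous (D : DGA F A) (a b : A) : Prop := ∃ c, a - b = D.d c

/-- `H^0 = F·[1]`. -/
def Connected (D : DGA F A) : Prop :=
  ∀ a ∈ D.grading 0, D.d a = 0 → ∃ c : F, a = c • (1 : A)

/-- Connected and `H^k = 0` for `1 ≤ k ≤ r`.  An `(r-1)`-connected DGA in the sense of
the paper is one satisfying `RConnected (r-1)`. -/
def RConnected (D : DGA F A) (r : ℤ) : Prop :=
  D.Connected ∧ ∀ k : ℤ, 1 ≤ k → k ≤ r → ∀ a ∈ D.grading k, D.d a = 0 → D.IsExact a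

/-- A harmonic subspace: a graded complement of the coboundaries inside the cocycles. -/
def IsHarmonicFamily (D : DGA F A) (H : ℤ → Submodule F A) : Prop :=
  ∀ k : ℤ, H k ≤ D.Zc k ∧ Disjoint (D.Bc k) (H k) ∧ D.Zc k ≤ D.Bc k ⊔ H k

/-- The operator `d⁻` attached to a decomposition `A = dA ⊕ H ⊕ B`: the inverse of
`d : B → dA` extended by `0` on `H ⊕ B`. -/
def IsDminus (D : DGA F A) (H B : ℤ → Submodule F A) (dm : A →ₗ[F] A) : Prop :=
  (∀ k : ℤ, ∀ b ∈ B k, dm (D.d b) = b) ∧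
  (∀ k : ℤ, ∀ h ∈ H k, dm h = 0) ∧
  (∀ k : ℤ, ∀ b ∈ B k, dm b = 0) ∧
  (∀ k : ℤ, ∀ a ∈ D.grading k, dm a ∈ B (k - 1))

/-- The projection `π_H : A → H` with kernel `dA ⊕ B`. -/
def IsHarmonicProj (D : DGA F A) (H B : ℤ → Submodule F A) (pH : A →ₗ[F] A) : Prop :=
  (∀ k : ℤ, ∀ h ∈ H k, pH h = h) ∧
  (∀ k : ℤ, ∀ b ∈ B k, pH b = 0) ∧
  (∀ a : A, pH (D.d a) = 0) ∧
  (∀ k : ℤ, ∀ a ∈ D.grading k, pH a ∈ H k)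

/-- The degree of the entry `a i j` of a defining system: `|x_i| + ⋯ + |x_j| - (j - i)`. -/
def degSum (deg : ℕ → ℤ) (i j : ℕ) : ℤ :=
  (∑ t ∈ Finset.Icc i j, deg t) - ((j - i : ℕ) : ℤ)

/-- A defining system for the `l`-th order Massey product of the classes of the
cocycles `x 1, …, x l` (of degrees `deg 1, …, deg l`). -/
def IsDefiningSystem (D : DGA F A) (l : ℕ) (deg : ℕ → ℤ) (x : ℕ → A)
    (a : ℕ → ℕ → A) : Prop :=
  (∀ i : ℕ, 1 ≤ i → i ≤ l →
      a i i ∈ D.grading (deg i) ∧ D.d (a i i) = 0 ∧ D.Cohomologous (a i i) (x i)) ∧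
  (∀ i j : ℕ, 1 ≤ i → i ≤ j → j ≤ l → a i j ∈ D.grading (degSum deg i j)) ∧
  (∀ i j : ℕ, 1 ≤ i → i < j → j ≤ l → ¬(i = 1 ∧ j = l) →
    D.d (a i j) = ∑ k ∈ Finset.Ico i j, ((-1 : F) ^ degSum deg i k) • (a i k * a (k + 1) j))

/-- The cocycle `∑ ā_{1k} a_{k+1,l}` produced by a defining system. -/
def masseyOut (D : DGA F A) (l : ℕ) (deg : ℕ → ℤ) (a : ℕ → ℕ → A) : A :=
  ∑ k ∈ Finset.Ico 1 l, ((-1 : F) ^ degSum deg 1 k) • (a 1 k * a (k + 1) l)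

/-- `(x 1, …, x l)` is a Massey `l`-tuple: the Massey product is nonempty. -/
def IsMasseyTuple (D : DGA F A) (l : ℕ) (deg : ℕ → ℤ) (x : ℕ → A) : Prop :=
  (∀ i : ℕ, 1 ≤ i → i ≤ l → x i ∈ D.Zc (deg i)) ∧ ∃ a, D.IsDefiningSystem l deg x a

/-- The `l`-th order Massey product of `(x 1, …, x l)` is trivial: it contains `0`. -/
def MasseyTrivial (D : DGA F A) (l : ℕ) (deg : ℕ → ℤ) (x : ℕ → A) : Prop :=
  ∃ a, D.IsDefiningSystem l deg x a ∧ D.IsExact (D.masseyOut l deg a)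

end DGA

/-- A differential graded commutative algebra (DGCA) over `F`. -/
structure DGCA (F : Type u) (A : Type v) [Field F] [Ring A] [Algebra F A]
    extends DGA F A where
  gcomm : ∀ {i j : ℤ} (a b : A), a ∈ grading i → b ∈ grading j →
    a * b = ((-1 : F) ^ (i * j)) • (b * a)

/-- A Poincaré DGCA of degree `n`: a DGCA concentrated in degrees `0, …, n`, with finite
dimensional cohomology, equipped with a linear functional `∫` (given here as `intg`, a
functional on `A` vanishing in degrees `≠ n` and on coboundaries) such that the induced
pairing `⟨a, b⟩ = ∫ [a * b]` is nondegenerate on cohomology. -/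
structure PoincareDGCA (F : Type u) (A : Type v) [Field F] [Ring A] [Algebra F A]
    (n : ℤ) extends DGCA F A where
  top : ∀ i : ℤ, n < i → grading i = ⊥
  fin_cohomology : ∀ k : ℤ, ∃ W : Submodule F A, FiniteDimensional F W ∧
    ∀ a ∈ grading k, d a = 0 → ∃ w ∈ W, ∃ c, a - w = d c
  intg : A →ₗ[F] F
  intg_deg : ∀ i : ℤ, i ≠ n → ∀ a ∈ grading i, intg a = 0
  intg_d : ∀ a : A, intg (d a) = 0
  nondeg : ∀ i : ℤ, ∀ a ∈ grading i, d a = 0 →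
    (∀ b ∈ grading (n - i), d b = 0 → intg (a * b) = 0) → ∃ c, a = d c

namespace PoincareDGCA

variable {F : Type u} {A : Type v} [Field F] [Ring A] [Algebra F A] {n : ℤ}

/-- The null space `A⊥` of the induced pairing `⟨a, b⟩ = ∫ (a * b)` on `A`. -/
def perp (P : PoincareDGCA F A n) : Submodule F A :=
  ⨅ b : A, LinearMap.ker (P.intg ∘ₗ LinearMap.mulRight F b)

/-- `A = dA ⊕ H ⊕ B` is a Hodge type decomposition: `H` is a harmonic subspace,
`B` is a graded complement, and `⟨H ⊕ B, B⟩ = 0`. -/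
def IsHodge (P : PoincareDGCA F A n) (H B : ℤ → Submodule F A) : Prop :=
  P.toDGA.IsHarmonicFamily H ∧
  (∀ k : ℤ, B k ≤ P.grading k) ∧
  (∀ k : ℤ, Disjoint (P.toDGA.Bc k ⊔ H k) (B k)) ∧
  (∀ k : ℤ, P.grading k ≤ P.toDGA.Bc k ⊔ H k ⊔ B k) ∧
  (∀ j k : ℤ, ∀ a ∈ H j ⊔ B j, ∀ b ∈ B k, P.intg (a * b) = 0)

/-- A Poincaré DGCA of Hodge type: one admitting a Hodge type decomposition. -/
def HodgeType (P : PoincareDGCA F A n) : Prop := ∃ H B, P.IsHodge H B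

end PoincareDGCA

/-- A bundled DGCA over `F`. -/
structure BDGCA (F : Type u) [Field F] : Type (max (u + 1) (v + 1)) where
  carrier : Type v
  [ringInst : Ring carrier]
  [algInst : Algebra F carrier]
  str : DGCA F carrier

attribute [instance] BDGCA.ringInst BDGCA.algInst

/-- A morphism of DGCAs: an algebra homomorphism preserving the grading and
commuting with the differentials. -/
structure DGCAHom {F : Type u} [Field F] (X Y : BDGCA.{u, v} F) where
  f : X.carrier →ₐ[F] Y.carrier
  map_grading : ∀ i : ℤ, ∀ a ∈ X.str.grading i, f a ∈ Y.str.grading i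
  map_d : ∀ a, f (X.str.d a) = Y.str.d (f a)

/-- A quasi-isomorphism: a DGCA morphism inducing an isomorphism on cohomology. -/
def DGCAHom.QuasiIso {F : Type u} [Field F] {X Y : BDGCA.{u, v} F}
    (φ : DGCAHom X Y) : Prop :=
  (∀ i : ℤ, ∀ a ∈ X.str.grading i, X.str.d a = 0 →
    (∃ b, φ.f a = Y.str.d b) → ∃ c, a = X.str.d c) ∧
  (∀ i : ℤ, ∀ a' ∈ Y.str.grading i, Y.str.d a' = 0 →
    ∃ a ∈ X.str.grading i, X.str.d a = 0 ∧ ∃ b, φ.f a - a' = Y.str.d b)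

/-- Two DGCAs are equivalent if they are joined by a finite zig-zag of
quasi-isomorphisms. -/
def DGCAEquivalent {F : Type u} [Field F] : BDGCA.{u, v} F → BDGCA.{u, v} F → Prop :=
  Relation.EqvGen fun X Y => ∃ φ : DGCAHom X Y, φ.QuasiIso

/-- A DGCA is formal if it is equivalent to a DGCA with zero differential
(equivalently, to its cohomology with the zero differential). -/
def DGCAFormal {F : Type u} [Field F] (X : BDGCA.{u, v} F) : Prop :=
  ∃ Y : BDGCA.{u, v} F, Y.str.d = 0 ∧ DGCAEquivalent X Y

namespace DGA

variable {F : Type u} {A : Type v} [Field F] [Ring A] [Algebra F A]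

/-- The projection of `A` onto its component of degree `i`. -/
noncomputable def proj (D : DGA F A) (i : ℤ) : A →ₗ[F] A :=
  letI := D.internal.chooseDecomposition
  (D.grading i).subtype ∘ₗ DirectSum.component F ℤ (fun j => D.grading j) i ∘ₗ
    (DirectSum.decomposeLinearEquiv D.grading).toLinearMap

lemma proj_mem (D : DGA F A) (i : ℤ) (a : A) : D.proj i a ∈ D.grading i :=
  Subtype.property _

lemma proj_same (D : DGA F A) {i : ℤ} {a : A} (ha : a ∈ D.grading i) : D.proj i a = a := by
  let := D.internal.chooseDecomposition
  exact DirectSum.decompose_of_mem_same D.grading ha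

lemma proj_ne (D : DGA F A) {i j : ℤ} {a : A} (ha : a ∈ D.grading i) (hij : i ≠ j) :
    D.proj j a = 0 := by
  let := D.internal.chooseDecomposition
  exact DirectSum.decompose_of_mem_ne D.grading ha hij

lemma homogeneous_induction (D : DGA F A) {p : A → Prop}
    (hom : ∀ i, ∀ a ∈ D.grading i, p a) (zero : p 0)
    (add : ∀ a b, p a → p b → p (a + b)) (a : A) : p a := by
  have ha : a ∈ ⨆ i, D.grading i := by
    rw [D.internal.submodule_iSup_eq_top]; trivial
  exact Submodule.iSup_induction D.grading (motive := p) ha hom zero add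

end DGA

section Descent

variable {F : Type*} {M N Q : Type*} [Field F] [AddCommGroup M] [Module F M]
  [AddCommGroup N] [Module F N] [AddCommGroup Q] [Module F Q]

/-- The factorization of a linear map through a surjection whose kernel it kills. -/
noncomputable def LinearMap.descend (π : M →ₗ[F] Q) (hπ : Function.Surjective π)
    (f : M →ₗ[F] N) (h : ∀ a, π a = 0 → f a = 0) : Q →ₗ[F] N :=
  (LinearMap.ker π).liftQ f (fun a ha => h a ha) ∘ₗ
    (π.quotKerEquivOfSurjective hπ).symm.toLinearMap

lemma LinearMap.descend_apply (π : M →ₗ[F] Q) (hπ : Function.Surjective π)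
    (f : M →ₗ[F] N) (h : ∀ a, π a = 0 → f a = 0) (a : M) :
    LinearMap.descend π hπ f h (π a) = f a := by
  have : (π.quotKerEquivOfSurjective hπ).symm (π a) = Submodule.Quotient.mk a := by
    rw [LinearEquiv.symm_apply_eq]; rfl
  simp only [LinearMap.descend, LinearMap.comp_apply, LinearEquiv.coe_coe, this]
  rfl

end Descent

namespace DGA

variable {F : Type u} {A : Type v} [Field F] [Ring A] [Algebra F A]
  {Q : Type*} [Ring Q] [Algebra F Q]

/-- The internal grading induced on the image of a surjection with graded kernel. -/
lemma isInternal_map (D : DGA F A) (π : A →ₐ[F] Q) (hπ : Function.Surjective π)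
    (hproj : ∀ i a, π a = 0 → π (D.proj i a) = 0) :
    DirectSum.IsInternal fun i => (D.grading i).map π.toLinearMap := by
  rw [DirectSum.isInternal_submodule_iff_iSupIndep_and_iSup_eq_top]
  constructor
  · intro i
    let q := LinearMap.descend π.toLinearMap hπ (π.toLinearMap ∘ₗ D.proj i) (hproj i)
    have hq (a : A) : q (π a) = π (D.proj i a) := LinearMap.descend_apply _ hπ _ (hproj i) a
    rw [Submodule.disjoint_def]
    rintro _ ⟨a, ha, rfl⟩ hx
    have hle : (⨆ (j) (_ : j ≠ i), (D.grading j).map π.toLinearMap) ≤ LinearMap.ker q := by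
      refine iSup₂_le fun j hj => ?_
      rintro _ ⟨b, hb, rfl⟩
      change q (π b) = 0
      rw [hq, D.proj_ne hb hj, map_zero]
    have h0 : q (π a) = 0 := hle hx
    rwa [hq, D.proj_same ha] at h0
  · rw [← Submodule.map_iSup, D.internal.submodule_iSup_eq_top, Submodule.map_top,
      LinearMap.range_eq_top]
    exact hπ

/-- The DGA structure on the quotient by a graded differential ideal, presented as a
surjection `π` whose kernel is stable under the degree projections and the differential. -/
noncomputable def quotient (D : DGA F A) (π : A →ₐ[F] Q) (hπ : Function.Surjective π)
    (hproj : ∀ i a, π a = 0 → π (D.proj i a) = 0)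
    (hd : ∀ a, π a = 0 → π (D.d a) = 0) : DGA F Q :=
  let dQ := LinearMap.descend π.toLinearMap hπ (π.toLinearMap ∘ₗ D.d) hd
  have hdQ (a : A) : dQ (π a) = π (D.d a) := LinearMap.descend_apply _ hπ _ hd a
  { grading := fun i => (D.grading i).map π.toLinearMap
    internal := D.isInternal_map π hπ hproj
    nonneg := fun i hi => by rw [D.nonneg i hi, Submodule.map_bot]
    one_mem := ⟨1, D.one_mem, map_one π⟩
    mul_mem := by
      rintro i j _ _ ⟨a, ha, rfl⟩ ⟨b, hb, rfl⟩
      exact ⟨a * b, D.mul_mem ha hb, map_mul π a b⟩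
    d := dQ
    d_mem := by
      rintro i _ ⟨a, ha, rfl⟩
      exact ⟨D.d a, D.d_mem ha, (hdQ a).symm⟩
    d_d := fun a => by
      obtain ⟨a, rfl⟩ := hπ a
      rw [hdQ, hdQ, D.d_d, map_zero]
    leibniz := by
      rintro i _ b ⟨a, ha, rfl⟩
      obtain ⟨b, rfl⟩ := hπ b
      change dQ (π a * π b) = dQ (π a) * π b + (-1 : F) ^ i • (π a * dQ (π b))
      rw [← map_mul, hdQ, hdQ, hdQ, D.leibniz a b ha]
      simp only [map_add, map_mul, map_smul] }

lemma quotient_d (D : DGA F A) (π : A →ₐ[F] Q) (hπ : Function.Surjective π)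
    (hproj : ∀ i a, π a = 0 → π (D.proj i a) = 0)
    (hd : ∀ a, π a = 0 → π (D.d a) = 0) (a : A) :
    (D.quotient π hπ hproj hd).d (π a) = π (D.d a) :=
  LinearMap.descend_apply _ hπ _ hd a

end DGA

namespace PoincareDGCA

variable {F : Type u} {A : Type v} [Field F] [Ring A] [Algebra F A] {n : ℤ}

lemma mem_perp (P : PoincareDGCA F A n) {a : A} :
    a ∈ P.perp ↔ ∀ b, P.intg (a * b) = 0 := by
  simp [perp]

lemma mem_perp_of_homogeneous (P : PoincareDGCA F A n) {a : A}
    (h : ∀ j, ∀ b ∈ P.grading j, P.intg (a * b) = 0) : a ∈ P.perp := by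
  refine P.mem_perp.2 fun b => P.homogeneous_induction h (by simp) ?_ b
  intro x y hx hy
  rw [mul_add, map_add, hx, hy, add_zero]

lemma intg_mul_eq_zero (P : PoincareDGCA F A n) {i j : ℤ} {a b : A}
    (ha : a ∈ P.grading i) (hb : b ∈ P.grading j) (h : i + j ≠ n) : P.intg (a * b) = 0 :=
  P.intg_deg _ h _ (P.mul_mem ha hb)

lemma intg_proj_mul (P : PoincareDGCA F A n) {i j : ℤ} (hij : i + j = n) (a : A) {b : A}
    (hb : b ∈ P.grading j) : P.intg (P.proj i a * b) = P.intg (a * b) := by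
  induction a using P.homogeneous_induction with
  | zero => simp
  | add x y hx hy => simp only [map_add, add_mul, hx, hy]
  | hom k a ha =>
    by_cases hk : k = i
    · rw [P.proj_same (hk ▸ ha)]
    · rw [P.proj_ne ha hk, zero_mul, map_zero, P.intg_mul_eq_zero ha hb (by omega)]

lemma intg_mul_proj (P : PoincareDGCA F A n) {i j : ℤ} (hij : i + j = n) {a : A}
    (ha : a ∈ P.grading i) (b : A) : P.intg (a * P.proj j b) = P.intg (a * b) := by
  induction b using P.homogeneous_induction with
  | zero => simp
  | add x y hx hy => simp only [map_add, mul_add, hx, hy]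
  | hom k b hb =>
    by_cases hk : k = j
    · rw [P.proj_same (hk ▸ hb)]
    · rw [P.proj_ne hb hk, mul_zero, map_zero, P.intg_mul_eq_zero ha hb (by omega)]

/-- Integration by parts. -/
lemma intg_d_mul (P : PoincareDGCA F A n) {j : ℤ} (a : A) {b : A} (hb : b ∈ P.grading j) :
    P.intg (P.d a * b) = -((-1 : F) ^ (n - 1 - j) * P.intg (a * P.d b)) := by
  induction a using P.homogeneous_induction with
  | zero => simp
  | add x y hx hy => simp only [map_add, add_mul, hx, hy]; ring
  | hom i a ha =>
    by_cases h : i + 1 + j = n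
    · have h0 := P.intg_d (a * b)
      rw [P.leibniz a b ha, map_add, map_smul, smul_eq_mul] at h0
      rw [show n - 1 - j = i by omega]
      exact eq_neg_of_add_eq_zero_left h0
    · rw [P.intg_mul_eq_zero (P.d_mem ha) hb h,
        P.intg_mul_eq_zero ha (P.d_mem hb) (by omega)]
      simp

lemma proj_mem_perp (P : PoincareDGCA F A n) (i : ℤ) {a : A} (ha : a ∈ P.perp) :
    P.proj i a ∈ P.perp := by
  refine P.mem_perp_of_homogeneous fun j b hb => ?_
  by_cases h : i + j = n
  · rw [P.intg_proj_mul h a hb, P.mem_perp.1 ha]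
  · exact P.intg_mul_eq_zero (P.proj_mem i a) hb h

lemma intg_mul_of_mem_perp (P : PoincareDGCA F A n) {a : A} (ha : a ∈ P.perp) (c : A) :
    P.intg (c * a) = 0 := by
  induction c using P.homogeneous_induction with
  | zero => simp
  | add x y hx hy => rw [add_mul, map_add, hx, hy, add_zero]
  | hom j c hc =>
    rw [← P.intg_mul_proj (add_sub_cancel j n) hc a, P.gcomm c _ hc (P.proj_mem _ a),
      map_smul, P.mem_perp.1 (P.proj_mem_perp _ ha), smul_zero]

lemma mul_mem_perp_right (P : PoincareDGCA F A n) {a : A} (ha : a ∈ P.perp) (c : A) :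
    a * c ∈ P.perp :=
  P.mem_perp.2 fun b => by rw [mul_assoc]; exact P.mem_perp.1 ha _

lemma mul_mem_perp_left (P : PoincareDGCA F A n) {a : A} (ha : a ∈ P.perp) (c : A) :
    c * a ∈ P.perp :=
  P.mem_perp.2 fun b => by
    rw [mul_assoc]; exact P.intg_mul_of_mem_perp (P.mul_mem_perp_right ha b) c

lemma d_mem_perp (P : PoincareDGCA F A n) {a : A} (ha : a ∈ P.perp) : P.d a ∈ P.perp :=
  P.mem_perp_of_homogeneous fun _ b hb => by
    rw [P.intg_d_mul a hb, P.mem_perp.1 ha, mul_zero, neg_zero]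

/-- The null space as an ideal. -/
def perpIdeal (P : PoincareDGCA F A n) : Ideal A where
  carrier := P.perp
  add_mem' := P.perp.add_mem
  zero_mem' := P.perp.zero_mem
  smul_mem' c _ ha := P.mul_mem_perp_left ha c

instance (P : PoincareDGCA F A n) : P.perpIdeal.IsTwoSided where
  mul_mem_of_left c ha := P.mul_mem_perp_right ha c

/-- In a Hodge type decomposition, an element of `B` lies in the null space as soon as its
differential does. -/
lemma IsHodge.mem_perp_of_d_mem {P : PoincareDGCA F A n} {H B : ℤ → Submodule F A}
    (h : P.IsHodge H B) {k : ℤ} {β : A} (hβ : β ∈ B k) (hd : P.d β ∈ P.perp) :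
    β ∈ P.perp := by
  obtain ⟨hH, hB, -, hsup, horth⟩ := h
  refine P.mem_perp_of_homogeneous fun j b hb => ?_
  have hb' := hsup j hb
  rw [sup_assoc] at hb'
  obtain ⟨_, ⟨x, hx, rfl⟩, y, hy, rfl⟩ := Submodule.mem_sup.1 hb'
  have hyj : y ∈ P.grading j :=
    sup_le (fun z hz => ((hH j).1 hz).1) (hB j) hy
  have hdx : P.intg (β * P.d x) = 0 := by
    have h0 := P.mem_perp.1 hd x
    rw [P.intg_d_mul β hx, neg_eq_zero] at h0
    exact (mul_eq_zero.1 h0).resolve_left (zpow_ne_zero _ (neg_ne_zero.2 one_ne_zero))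
  rw [mul_add, map_add, hdx, P.gcomm β y (hB k hβ) hyj, map_smul, horth j k y hy β hβ,
    smul_zero, add_zero]

/-- For Hodge type, an element closed modulo the null space is congruent to a cocycle. -/
lemma HodgeType.exists_cocycle {P : PoincareDGCA F A n} (h : P.HodgeType) {k : ℤ} {x : A}
    (hx : x ∈ P.grading k) (hd : P.d x ∈ P.perp) :
    ∃ a ∈ P.grading k, P.d a = 0 ∧ a - x ∈ P.perp := by
  obtain ⟨H, B, hHB⟩ := h
  obtain ⟨z, hz, β, hβ, rfl⟩ := Submodule.mem_sup.1 (hHB.2.2.2.1 k hx)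
  have hz0 : P.d z = 0 := by
    obtain ⟨_, ⟨y, -, rfl⟩, w, hw, rfl⟩ := Submodule.mem_sup.1 hz
    rw [map_add, P.d_d, ((hHB.1 k).1 hw).2, add_zero]
  rw [map_add, hz0, zero_add] at hd
  refine ⟨z, ?_, hz0, ?_⟩
  · simpa using (P.grading k).sub_mem hx (hHB.2.1 k hβ)
  · rw [sub_add_cancel_left]
    exact P.perp.neg_mem (hHB.mem_perp_of_d_mem hβ hd)

/-- A cocycle which is exact modulo the null space is exact. -/
lemma exact_of_sub_mem_perp (P : PoincareDGCA F A n) {i : ℤ} {a c : A}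
    (ha : a ∈ P.grading i) (hd : P.d a = 0) (hc : a - P.d c ∈ P.perp) : ∃ b, a = P.d b := by
  refine P.nondeg i a ha hd fun b hb hdb => ?_
  have h := P.mem_perp.1 hc b
  rw [sub_mul, map_sub, P.intg_d_mul c hb, hdb] at h
  simpa using h

section Quotient

variable (P : PoincareDGCA F A n) {Q : Type*} [Ring Q] [Algebra F Q]
  (π : A →ₐ[F] Q) (hπ : Function.Surjective π) (hker : ∀ a, π a = 0 ↔ a ∈ P.perp)

/-- The DGA structure on the quotient of a Poincaré DGCA by its null space. -/
noncomputable def quotientDGA : DGA F Q :=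
  P.toDGA.quotient π hπ (fun i a ha => (hker _).2 (P.proj_mem_perp i ((hker a).1 ha)))
    (fun a ha => (hker _).2 (P.d_mem_perp ((hker a).1 ha)))

lemma quotientDGA_d (a : A) : (P.quotientDGA π hπ hker).d (π a) = π (P.d a) :=
  DGA.quotient_d ..

/-- The integral on the quotient of a Poincaré DGCA by its null space. -/
noncomputable def quotientIntg : Q →ₗ[F] F :=
  LinearMap.descend π.toLinearMap hπ P.intg fun a ha => by
    simpa using P.mem_perp.1 ((hker a).1 ha) 1

lemma quotientIntg_apply (a : A) : P.quotientIntg π hπ hker (π a) = P.intg a :=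
  LinearMap.descend_apply ..

lemma exists_cocycle_lift (h : P.HodgeType) {k : ℤ} {a' : Q}
    (ha' : a' ∈ (P.quotientDGA π hπ hker).grading k)
    (hd : (P.quotientDGA π hπ hker).d a' = 0) :
    ∃ a ∈ P.grading k, P.d a = 0 ∧ π a = a' := by
  obtain ⟨x, hx, rfl⟩ := ha'
  obtain ⟨a, ha, hda, hax⟩ := h.exists_cocycle hx
    ((hker _).1 ((P.quotientDGA_d π hπ hker x).symm.trans hd))
  refine ⟨a, ha, hda, ?_⟩
  rwa [← hker, map_sub, sub_eq_zero] at hax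

/-- The Poincaré DGCA structure on the quotient of a Poincaré DGCA of Hodge type by its
null space. -/
noncomputable def quotient (h : P.HodgeType) : PoincareDGCA F Q n where
  toDGA := P.quotientDGA π hπ hker
  gcomm := by
    rintro i j _ _ ⟨a, ha, rfl⟩ ⟨b, hb, rfl⟩
    have hab := congrArg π (P.gcomm a b ha hb)
    rwa [map_smul, map_mul, map_mul] at hab
  top i hi := by
    change (P.grading i).map π.toLinearMap = ⊥
    rw [P.top i hi, Submodule.map_bot]
  fin_cohomology k := by
    obtain ⟨W, hW, hWk⟩ := P.fin_cohomology k
    refine ⟨W.map π.toLinearMap, inferInstance, fun a' ha' hd => ?_⟩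
    obtain ⟨a, ha, hda, rfl⟩ := P.exists_cocycle_lift π hπ hker h ha' hd
    obtain ⟨w, hw, c, hc⟩ := hWk a ha hda
    exact ⟨π w, ⟨w, hw, rfl⟩, π c, by rw [P.quotientDGA_d, ← hc, map_sub]⟩
  intg := P.quotientIntg π hπ hker
  intg_deg := by
    rintro i hi _ ⟨a, ha, rfl⟩
    exact (P.quotientIntg_apply π hπ hker a).trans (P.intg_deg i hi a ha)
  intg_d a' := by
    obtain ⟨a, rfl⟩ := hπ a'
    rw [P.quotientDGA_d, P.quotientIntg_apply, P.intg_d]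
  nondeg i a' ha' hd hab := by
    obtain ⟨a, ha, hda, rfl⟩ := P.exists_cocycle_lift π hπ hker h ha' hd
    obtain ⟨c, rfl⟩ := P.nondeg i a ha hda fun b hb hdb => by
      rw [← P.quotientIntg_apply π hπ hker, map_mul]
      exact hab (π b) ⟨b, hb, rfl⟩ (by rw [P.quotientDGA_d, hdb, map_zero])
    exact ⟨π c, (P.quotientDGA_d π hπ hker c).symm⟩

lemma quotient_perp (h : P.HodgeType) : (P.quotient π hπ hker h).perp = ⊥ := by
  rw [eq_bot_iff]
  intro a' ha'
  obtain ⟨a, rfl⟩ := hπ a'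
  refine (hker a).2 (P.mem_perp.2 fun b => ?_)
  rw [← P.quotientIntg_apply π hπ hker, map_mul]
  exact (mem_perp _).1 ha' (π b)

end Quotient

/-- The projection of a Poincaré DGCA of Hodge type onto its quotient, as a DGCA morphism. -/
noncomputable def quotientHom (P : PoincareDGCA F A n) (h : P.HodgeType) {Q : Type v} [Ring Q]
    [Algebra F Q] (π : A →ₐ[F] Q) (hπ : Function.Surjective π)
    (hker : ∀ a, π a = 0 ↔ a ∈ P.perp) :
    DGCAHom (BDGCA.mk A P.toDGCA) (BDGCA.mk Q (P.quotient π hπ hker h).toDGCA) where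
  f := π
  map_grading _ a ha := ⟨a, ha, rfl⟩
  map_d a := (P.quotientDGA_d π hπ hker a).symm

lemma quotientHom_quasiIso (P : PoincareDGCA F A n) (h : P.HodgeType) {Q : Type v} [Ring Q]
    [Algebra F Q] (π : A →ₐ[F] Q) (hπ : Function.Surjective π)
    (hker : ∀ a, π a = 0 ↔ a ∈ P.perp) : (P.quotientHom h π hπ hker).QuasiIso := by
  constructor
  · rintro i a ha hda ⟨b, hb⟩
    obtain ⟨c, rfl⟩ := hπ b
    refine P.exact_of_sub_mem_perp (c := c) ha hda ((hker _).1 ?_)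
    rw [map_sub, sub_eq_zero]
    exact hb.trans (P.quotientDGA_d π hπ hker c)
  · intro i a' ha' hd
    obtain ⟨a, ha, hda, rfl⟩ := P.exists_cocycle_lift π hπ hker h ha' hd
    exact ⟨a, ha, hda, 0, (sub_self (π a)).trans (map_zero _).symm⟩

end PoincareDGCA

/-- For a Poincaré DGCA of Hodge type, the canonical projection
`π : A → Q = A/A⊥` is a quasi-isomorphism of DGCAs, the induced pairing
`⟨π a, π b⟩_Q = ⟨a, b⟩` is well defined and nondegenerate, and hence every Poincaré
DGCA of Hodge type is equivalent to a nondegenerate one of the same degree. -/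
theorem statement_2 {F : Type u} {A : Type v} [Field F] [Ring A] [Algebra F A] {n : ℤ}
    (P : PoincareDGCA F A n) (hHodge : P.HodgeType) :
    ∃ (Q : BDGCA.{u, v} F) (PQ : PoincareDGCA F Q.carrier n)
      (π : DGCAHom (BDGCA.mk A P.toDGCA) Q),
      PQ.toDGCA = Q.str ∧
      Function.Surjective π.f ∧
      (∀ a : A, π.f a = 0 ↔ a ∈ P.perp) ∧
      π.QuasiIso ∧
      (∀ a : A, PQ.intg (π.f a) = P.intg a) ∧
      PQ.perp = ⊥ ∧
      DGCAEquivalent (BDGCA.mk A P.toDGCA) Q := by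
  have hπ : Function.Surjective (Ideal.Quotient.mkₐ F P.perpIdeal) :=
    Ideal.Quotient.mkₐ_surjective F P.perpIdeal
  have hker (a : A) : Ideal.Quotient.mkₐ F P.perpIdeal a = 0 ↔ a ∈ P.perp :=
    Ideal.Quotient.eq_zero_iff_mem
  have hq := P.quotientHom_quasiIso hHodge _ hπ hker
  exact ⟨_, P.quotient _ hπ hker hHodge, P.quotientHom hHodge _ hπ hker, rfl, hπ, hker, hq,
    P.quotientIntg_apply _ hπ hker, P.quotient_perp _ hπ hker hHodge,
    Relation.EqvGen.rel _ _ ⟨_, hq⟩⟩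
end

section
/- Let A* be a simply connected Poincaré DGCA of degree n endowed with a Hodge type decomposition with harmonic subspace H*. Then the small algebra A*_small is given by the recursion: A^0_small = F·1_A, A^1_small = 0, and for k ≥ 2, A^k_small = H^k ⊕ dd⁻(span{a·b : a ∈ A^{l1}_small, b ∈ A^{l2}_small, l1, l2 ≥ 2, l1 + l2 = k}) ⊕ d⁻(span{a·b : a ∈ A^{l1}_small, b ∈ A^{l2}_small, l1, l2 ≥ 2, l1 + l2 = k + 1}). In particular, A*_small is finite dimensional. -/
universe u v

open scoped TensorProduct

variable {F : Type u} {A : Type v} [Field F] [Ring A] [Algebra F A]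

/-- An `H*`-subalgebra: a differential graded subalgebra of `A*` containing the
harmonic subspace `H` and invariant under `d` and `d⁻`. -/
def IsHSubalgebra (D : DGA F A) (H : ℤ → Submodule F A) (dm : A →ₗ[F] A)
    (C : Subalgebra F A) : Prop :=
  (∀ k : ℤ, H k ≤ Subalgebra.toSubmodule C) ∧
  (∀ a ∈ C, D.d a ∈ C) ∧ (∀ a ∈ C, dm a ∈ C)

/-- The small algebra `A*_small`: the smallest `H*`-subalgebra of `A*`. -/
def smallAlgebra (D : DGA F A) (H : ℤ → Submodule F A) (dm : A →ₗ[F] A) :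
    Subalgebra F A :=
  sInf {C : Subalgebra F A | IsHSubalgebra D H dm C}

/-- The span of products `a * b` with `a ∈ C l₁`, `b ∈ C l₂`, `l₁, l₂ ≥ 2`,
`l₁ + l₂ = k`. -/
def pairSpan (C : ℤ → Submodule F A) (k : ℤ) : Submodule F A :=
  Submodule.span F {x : A | ∃ l1 l2 : ℤ, 2 ≤ l1 ∧ 2 ≤ l2 ∧ l1 + l2 = k ∧
    ∃ a ∈ C l1, ∃ b ∈ C l2, x = a * b}

theorem Submodule.mem_of_mem_iSup_of_mem {ι : Type*} {G R : ι → Submodule F A}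
    (hG : iSupIndep G) (hR : ∀ i, R i ≤ G i) {k : ι} {x : A}
    (hx : x ∈ ⨆ i, R i) (hxk : x ∈ G k) : x ∈ R k := by
  rw [iSup_split_single R k] at hx
  obtain ⟨r, hr, s, hs, rfl⟩ := Submodule.mem_sup.1 hx
  have hsG : s ∈ G k := by
    have := Submodule.sub_mem _ hxk (hR k hr)
    rwa [add_sub_cancel_left] at this
  have hs' : s ∈ ⨆ (j) (_ : j ≠ k), G j :=
    iSup_mono (fun j => iSup_mono fun _ => hR j) hs
  have h0 : s = 0 := Submodule.disjoint_def.1 (hG k) s hsG hs'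
  rwa [h0, add_zero]

namespace DGA

theorem mem_Bc_of_eq_d (D : DGA F A) {k : ℤ} {a c : A}
    (ha : a ∈ D.grading k) (hc : a = D.d c) : a ∈ D.Bc k := by
  have hind := D.internal.submodule_iSupIndep
  refine Submodule.mem_of_mem_iSup_of_mem (G := D.grading) hind (R := D.Bc) ?_ ?_ ha
  · rintro i _ ⟨y, hy, rfl⟩
    have := D.d_mem hy
    rwa [sub_add_cancel] at this
  · have hct : c ∈ ⨆ i, D.grading i := by
      rw [D.internal.submodule_iSup_eq_top]; trivial
    have hle : Submodule.map D.d (⨆ i, D.grading i) ≤ ⨆ i, D.Bc i := by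
      rw [Submodule.map_iSup]
      refine iSup_le fun i => le_trans (le_of_eq ?_) (le_iSup D.Bc (i + 1))
      rw [Bc, add_sub_cancel_right]
    exact hc ▸ hle (Submodule.mem_map_of_mem hct)

theorem d_one (D : DGA F A) : D.d 1 = 0 := by
  have h := D.leibniz (1 : A) 1 D.one_mem
  simpa using h

end DGA

theorem smallAlgebra_isHSubalgebra (D : DGA F A) (H : ℤ → Submodule F A) (dm : A →ₗ[F] A) :
    IsHSubalgebra D H dm (smallAlgebra D H dm) := by
  refine ⟨fun k h hh => ?_, fun a ha => ?_, fun a ha => ?_⟩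
  · exact Algebra.mem_sInf.2 fun C hC => hC.1 k hh
  · exact Algebra.mem_sInf.2 fun C hC => hC.2.1 a (Algebra.mem_sInf.1 ha C hC)
  · exact Algebra.mem_sInf.2 fun C hC => hC.2.2 a (Algebra.mem_sInf.1 ha C hC)

theorem smallAlgebra_le {D : DGA F A} {H : ℤ → Submodule F A} {dm : A →ₗ[F] A}
    {C : Subalgebra F A} (hC : IsHSubalgebra D H dm C) : smallAlgebra D H dm ≤ C :=
  sInf_le hC

theorem mul_mem_pairSpan {C : ℤ → Submodule F A} {i j : ℤ} {a b : A} (hi : 2 ≤ i) (hj : 2 ≤ j)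
    (ha : a ∈ C i) (hb : b ∈ C j) : a * b ∈ pairSpan C (i + j) :=
  Submodule.subset_span ⟨i, j, hi, hj, rfl, a, ha, b, hb, rfl⟩

theorem pairSpan_eq_bot (C : ℤ → Submodule F A) {k : ℤ} (hk : k < 4) : pairSpan C k = ⊥ := by
  refine (Submodule.span_eq_bot).2 ?_
  rintro x ⟨i, j, hi, hj, hij, -⟩
  omega

theorem pairSpan_le {C : ℤ → Submodule F A} {M : Submodule F A} {k : ℤ}
    (h : ∀ i j, i + j = k → ∀ a ∈ C i, ∀ b ∈ C j, a * b ∈ M) : pairSpan C k ≤ M := by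
  refine Submodule.span_le.2 ?_
  rintro _ ⟨i, j, -, -, hij, a, ha, b, hb, rfl⟩
  exact h i j hij a ha b hb

theorem pairSpan_finiteDimensional {C : ℤ → Submodule F A} {k : ℤ}
    (hC : ∀ l, l ≤ k - 2 → FiniteDimensional F (C l)) : FiniteDimensional F (pairSpan C k) := by
  have hfin : FiniteDimensional F
      (⨆ l : Finset.Icc 2 (k - 2), C l * C (k - l) : Submodule F A) := by
    have : ∀ l : Finset.Icc 2 (k - 2), FiniteDimensional F (C l * C (k - l) : Submodule F A) := by
      rintro ⟨l, hl⟩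
      rw [Finset.mem_Icc] at hl
      have h1 := hC l hl.2
      have h2 := hC (k - l) (by omega)
      exact Module.Finite.iff_fg.2
        ((Module.Finite.iff_fg.1 h1).mul (Module.Finite.iff_fg.1 h2))
    infer_instance
  refine Submodule.finiteDimensional_of_le (S₂ := ⨆ l : Finset.Icc 2 (k - 2), C l * C (k - l)) ?_
  refine Submodule.span_le.2 ?_
  rintro _ ⟨i, j, hi, hj, hij, a, ha, b, hb, rfl⟩
  have hmem : i ∈ Finset.Icc 2 (k - 2) := Finset.mem_Icc.2 ⟨hi, by omega⟩
  refine Submodule.mem_iSup_of_mem ⟨i, hmem⟩ (Submodule.mul_mem_mul ha ?_)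
  rwa [show k - i = j by omega]

/-- The pieces `F·1`, `0` and `Hᵏ + d d⁻(pairSpan C k) + d⁻(pairSpan C (k + 1))` for `k ≥ 2`
built from a family `C`. -/
def recursionPiece (D : DGA F A) (H : ℤ → Submodule F A) (dm : A →ₗ[F] A)
    (C : ℤ → Submodule F A) (k : ℤ) : Submodule F A :=
  if k = 0 then Submodule.span F {(1 : A)}
  else if 2 ≤ k then
    H k ⊔ Submodule.map (D.d ∘ₗ dm) (pairSpan C k) ⊔ Submodule.map dm (pairSpan C (k + 1))
  else ⊥

section recursionPiece

variable {D : DGA F A} {H : ℤ → Submodule F A} {dm : A →ₗ[F] A} {C : ℤ → Submodule F A}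

theorem recursionPiece_zero : recursionPiece D H dm C 0 = Submodule.span F {(1 : A)} :=
  if_pos rfl

theorem recursionPiece_of_two_le {k : ℤ} (hk : 2 ≤ k) : recursionPiece D H dm C k =
    H k ⊔ Submodule.map (D.d ∘ₗ dm) (pairSpan C k)
      ⊔ Submodule.map dm (pairSpan C (k + 1)) := by
  rw [recursionPiece, if_neg (by omega), if_pos hk]

theorem recursionPiece_eq_bot {k : ℤ} (h0 : k ≠ 0) (hk : k < 2) :
    recursionPiece D H dm C k = ⊥ := by
  rw [recursionPiece, if_neg h0, if_neg (by omega)]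

theorem d_dm_mem_recursionPiece {k : ℤ} {x : A} (hx : x ∈ pairSpan C k) :
    D.d (dm x) ∈ recursionPiece D H dm C k := by
  by_cases hk : k < 4
  · rw [pairSpan_eq_bot C hk, Submodule.mem_bot] at hx
    simp [hx]
  · rw [recursionPiece_of_two_le (by omega)]
    exact Submodule.mem_sup_left (Submodule.mem_sup_right ⟨x, hx, rfl⟩)

theorem dm_mem_recursionPiece {k : ℤ} {x : A} (hx : x ∈ pairSpan C (k + 1)) :
    dm x ∈ recursionPiece D H dm C k := by
  by_cases hk : k + 1 < 4
  · rw [pairSpan_eq_bot C hk, Submodule.mem_bot] at hx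
    simp [hx]
  · rw [recursionPiece_of_two_le (by omega)]
    exact Submodule.mem_sup_right ⟨x, hx, rfl⟩

theorem recursionPiece_le {k : ℤ} {M : Submodule F A}
    (hone : k = 0 → (1 : A) ∈ M) (hH : 2 ≤ k → H k ≤ M)
    (hd : 2 ≤ k → ∀ x ∈ pairSpan C k, D.d (dm x) ∈ M)
    (hdm : 2 ≤ k → ∀ x ∈ pairSpan C (k + 1), dm x ∈ M) :
    recursionPiece D H dm C k ≤ M := by
  rcases eq_or_ne k 0 with rfl | h0
  · rw [recursionPiece_zero]
    exact (Submodule.span_singleton_le_iff_mem _ _).2 (hone rfl)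
  · by_cases hk : 2 ≤ k
    · rw [recursionPiece_of_two_le hk]
      refine sup_le (sup_le (hH hk) ?_) ?_
      · rintro _ ⟨x, hx, rfl⟩
        exact hd hk x hx
      · rintro _ ⟨x, hx, rfl⟩
        exact hdm hk x hx
    · rw [recursionPiece_eq_bot h0 (by omega)]
      exact bot_le

end recursionPiece

namespace PoincareDGCA

variable {n : ℤ} {P : PoincareDGCA F A n} {H B : ℤ → Submodule F A} {dm : A →ₗ[F] A}

theorem IsHodge.harmonic_le (h : P.IsHodge H B) (k : ℤ) : H k ≤ P.grading k :=
  fun _ hx => ((h.1 k).1 hx).1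

theorem IsHodge.d_harmonic (h : P.IsHodge H B) {k : ℤ} {x : A} (hx : x ∈ H k) : P.d x = 0 :=
  ((h.1 k).1 hx).2

theorem IsHodge.eq_zero_of_exact (h : P.IsHodge H B) {k : ℤ} {x c : A} (hx : x ∈ H k)
    (hc : x = P.d c) : x = 0 :=
  Submodule.disjoint_def.1 (h.1 k).2.1 x
    (P.toDGA.mem_Bc_of_eq_d (h.harmonic_le k hx) hc) hx

theorem dm_dm (hdm : P.toDGA.IsDminus H B dm) {k : ℤ} {x : A}
    (hx : x ∈ P.grading k) : dm (dm x) = 0 :=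
  hdm.2.2.1 (k - 1) _ (hdm.2.2.2 k x hx)

theorem IsHodge.dm_mem (h : P.IsHodge H B) (hdm : P.toDGA.IsDminus H B dm) {k : ℤ} {x : A}
    (hx : x ∈ P.grading k) : dm x ∈ P.grading (k - 1) :=
  h.2.1 _ (hdm.2.2.2 k x hx)

theorem dm_d_dm (hdm : P.toDGA.IsDminus H B dm) {k : ℤ} {x : A}
    (hx : x ∈ P.grading k) : dm (P.d (dm x)) = dm x :=
  hdm.1 (k - 1) _ (hdm.2.2.2 k x hx)

/-- The homotopy identity `x = d d⁻ x + d⁻ d x + π_H x`. -/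
theorem IsHodge.exists_harmonic_part (h : P.IsHodge H B) (hdm : P.toDGA.IsDminus H B dm) {k : ℤ}
    {x : A} (hx : x ∈ P.grading k) : ∃ y ∈ H k, x = P.d (dm x) + dm (P.d x) + y := by
  have key : ∀ j, ∀ z ∈ P.grading j, ∃ b' ∈ B j, P.d z = P.d b' := by
    intro j z hz
    obtain ⟨u, hu, b, hb, rfl⟩ := Submodule.mem_sup.1 (h.2.2.2.1 j hz)
    obtain ⟨w, ⟨v, -, rfl⟩, y, hy, rfl⟩ := Submodule.mem_sup.1 hu
    exact ⟨b, hb, by simp [P.d_d, h.d_harmonic hy]⟩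
  obtain ⟨u, hu, b, hb, rfl⟩ := Submodule.mem_sup.1 (h.2.2.2.1 k hx)
  obtain ⟨w, ⟨v, hv, rfl⟩, y, hy, rfl⟩ := Submodule.mem_sup.1 hu
  obtain ⟨b', hb', hvb⟩ := key _ v hv
  refine ⟨y, hy, ?_⟩
  simp only [map_add, P.d_d, h.d_harmonic hy, hdm.2.1 k y hy, hdm.2.2.1 k b hb, hvb,
    hdm.1 _ b' hb', hdm.1 k b hb, map_zero]
  abel

theorem IsHodge.harmonic_finiteDimensional (h : P.IsHodge H B) (k : ℤ) :
    FiniteDimensional F (H k) := by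
  obtain ⟨W, hW, hWH⟩ := P.fin_cohomology k
  let q := (LinearMap.range P.d).mkQ
  have hmap : ∀ x : H k, q x ∈ W.map q := by
    intro x
    obtain ⟨w, hw, c, hc⟩ := hWH x (h.harmonic_le k x.2) (h.d_harmonic x.2)
    refine ⟨w, hw, ((Submodule.Quotient.eq _).2 ?_).symm⟩
    exact ⟨c, hc.symm⟩
  let f : H k →ₗ[F] W.map q := (q ∘ₗ (H k).subtype).codRestrict (W.map q) hmap
  refine FiniteDimensional.of_injective f ?_
  refine (injective_iff_map_eq_zero f).2 fun x hx => ?_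
  have h0 : q x = 0 := congrArg Subtype.val hx
  obtain ⟨c, hc⟩ := (Submodule.Quotient.mk_eq_zero _).1 h0
  exact Subtype.ext (h.eq_zero_of_exact x.2 hc.symm)

/-- The homogeneous components of the small algebra. -/
def smallPiece (P : PoincareDGCA F A n) (H : ℤ → Submodule F A) (dm : A →ₗ[F] A) (k : ℤ) :
    Submodule F A :=
  Subalgebra.toSubmodule (smallAlgebra P.toDGA H dm) ⊓ P.grading k

theorem pairSpan_smallPiece_le (P : PoincareDGCA F A n) (H : ℤ → Submodule F A)
    (dm : A →ₗ[F] A) (k : ℤ) : pairSpan (P.smallPiece H dm) k ≤ P.smallPiece H dm k := by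
  refine pairSpan_le ?_
  rintro i j rfl a ha b hb
  exact ⟨Subalgebra.mul_mem _ ha.1 hb.1, P.mul_mem ha.2 hb.2⟩

theorem IsHodge.recursionPiece_le_smallPiece (h : P.IsHodge H B)
    (hdm : P.toDGA.IsDminus H B dm) (k : ℤ) :
    recursionPiece P.toDGA H dm (P.smallPiece H dm) k ≤ P.smallPiece H dm k := by
  obtain ⟨hSH, hSd, hSdm⟩ := smallAlgebra_isHSubalgebra P.toDGA H dm
  refine recursionPiece_le ?_ ?_ ?_ ?_
  · rintro rfl
    exact ⟨Subalgebra.one_mem _, P.one_mem⟩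
  · exact fun _ => le_inf (hSH k) (h.harmonic_le k)
  · intro _ x hx
    have hx' := P.pairSpan_smallPiece_le H dm k hx
    have := P.d_mem (h.dm_mem hdm hx'.2)
    rw [sub_add_cancel] at this
    exact ⟨hSd _ (hSdm _ hx'.1), this⟩
  · intro _ x hx
    have hx' := P.pairSpan_smallPiece_le H dm _ hx
    have := h.dm_mem hdm hx'.2
    rw [add_sub_cancel_right] at this
    exact ⟨hSdm _ hx'.1, this⟩

theorem IsHodge.pairSpan_mul_mem_recursionPiece (h : P.IsHodge H B)
    (hdm : P.toDGA.IsDminus H B dm) {i j : ℤ} (hi : 2 ≤ i) (hj : 2 ≤ j) {a b : A}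
    (ha : a ∈ P.smallPiece H dm i) (hb : b ∈ P.smallPiece H dm j) :
    a * b ∈ recursionPiece P.toDGA H dm (P.smallPiece H dm) (i + j) := by
  obtain ⟨-, hSd, -⟩ := smallAlgebra_isHSubalgebra P.toDGA H dm
  have hab : a * b ∈ pairSpan (P.smallPiece H dm) (i + j) := mul_mem_pairSpan hi hj ha hb
  have hdab : P.d (a * b) ∈ pairSpan (P.smallPiece H dm) (i + j + 1) := by
    rw [P.leibniz a b ha.2]
    refine Submodule.add_mem _ ?_ (Submodule.smul_mem _ _ ?_)
    · rw [show i + j + 1 = (i + 1) + j by ring]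
      exact mul_mem_pairSpan (by omega) hj ⟨hSd _ ha.1, P.d_mem ha.2⟩ hb
    · rw [show i + j + 1 = i + (j + 1) by ring]
      exact mul_mem_pairSpan hi (by omega) ha ⟨hSd _ hb.1, P.d_mem hb.2⟩
  obtain ⟨y, hy, hxy⟩ := h.exists_harmonic_part hdm (P.mul_mem ha.2 hb.2)
  rw [hxy]
  refine Submodule.add_mem _ (Submodule.add_mem _ (d_dm_mem_recursionPiece hab)
    (dm_mem_recursionPiece hdab)) ?_
  rw [recursionPiece_of_two_le (by omega)]
  exact Submodule.mem_sup_left (Submodule.mem_sup_left hy)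

theorem IsHodge.mul_mem_recursionPiece (h : P.IsHodge H B)
    (hdm : P.toDGA.IsDminus H B dm) {i j : ℤ} {a b : A}
    (ha : a ∈ recursionPiece P.toDGA H dm (P.smallPiece H dm) i)
    (hb : b ∈ recursionPiece P.toDGA H dm (P.smallPiece H dm) j) :
    a * b ∈ recursionPiece P.toDGA H dm (P.smallPiece H dm) (i + j) := by
  rcases eq_or_ne i 0 with rfl | hi0
  · rw [recursionPiece_zero] at ha
    obtain ⟨c, rfl⟩ := Submodule.mem_span_singleton.1 ha
    rw [zero_add, smul_mul_assoc, one_mul]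
    exact Submodule.smul_mem _ _ hb
  rcases eq_or_ne j 0 with rfl | hj0
  · rw [recursionPiece_zero] at hb
    obtain ⟨c, rfl⟩ := Submodule.mem_span_singleton.1 hb
    rw [add_zero, mul_smul_comm, mul_one]
    exact Submodule.smul_mem _ _ ha
  rcases lt_or_ge i 2 with hi | hi
  · rw [recursionPiece_eq_bot hi0 hi, Submodule.mem_bot] at ha
    simp [ha]
  rcases lt_or_ge j 2 with hj | hj
  · rw [recursionPiece_eq_bot hj0 hj, Submodule.mem_bot] at hb
    simp [hb]
  exact h.pairSpan_mul_mem_recursionPiece hdm hi hj (h.recursionPiece_le_smallPiece hdm i ha)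
    (h.recursionPiece_le_smallPiece hdm j hb)

theorem IsHodge.harmonic_le_recursionPiece (h : P.IsHodge H B) (hsc : P.toDGA.RConnected 1)
    (C : ℤ → Submodule F A) (k : ℤ) : H k ≤ recursionPiece P.toDGA H dm C k := by
  intro x hx
  rcases lt_or_ge k 0 with hk | hk
  · have := h.harmonic_le k hx
    rw [P.nonneg k hk, Submodule.mem_bot] at this
    simp [this]
  rcases eq_or_ne k 0 with rfl | h0
  · obtain ⟨c, rfl⟩ := hsc.1 x (h.harmonic_le 0 hx) (h.d_harmonic hx)
    rw [recursionPiece_zero]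
    exact Submodule.mem_span_singleton.2 ⟨c, rfl⟩
  rcases lt_or_ge k 2 with hk2 | hk2
  · obtain ⟨c, hc⟩ := hsc.2 k (by omega) (by omega) x (h.harmonic_le k hx) (h.d_harmonic hx)
    simp [h.eq_zero_of_exact hx hc]
  · rw [recursionPiece_of_two_le hk2]
    exact Submodule.mem_sup_left (Submodule.mem_sup_left hx)

theorem IsHodge.smallAlgebra_le_iSup (h : P.IsHodge H B) (hsc : P.toDGA.RConnected 1)
    (hdm : P.toDGA.IsDminus H B dm) :
    Subalgebra.toSubmodule (smallAlgebra P.toDGA H dm) ≤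
      ⨆ k, recursionPiece P.toDGA H dm (P.smallPiece H dm) k := by
  set R := recursionPiece P.toDGA H dm (P.smallPiece H dm) with hR
  have hone : (1 : A) ∈ ⨆ k, R k := by
    refine Submodule.mem_iSup_of_mem 0 ?_
    rw [hR, recursionPiece_zero]
    exact Submodule.mem_span_singleton_self 1
  have hmul : ∀ x y, x ∈ ⨆ k, R k → y ∈ ⨆ k, R k → x * y ∈ ⨆ k, R k := by
    intro x y hx hy
    have hle : (⨆ k, R k) * (⨆ k, R k) ≤ ⨆ k, R k := by
      rw [Submodule.iSup_mul]
      refine iSup_le fun i => ?_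
      rw [Submodule.mul_iSup]
      refine iSup_le fun j => Submodule.mul_le.2 fun a ha b hb => ?_
      exact Submodule.mem_iSup_of_mem (i + j) (h.mul_mem_recursionPiece hdm ha hb)
    exact hle (Submodule.mul_mem_mul hx hy)
  have hgr : ∀ k, ∀ x ∈ pairSpan (P.smallPiece H dm) k, x ∈ P.grading k :=
    fun k x hx => (P.pairSpan_smallPiece_le H dm k hx).2
  have hd : (⨆ k, R k) ≤ (⨆ k, R k).comap P.d := by
    refine iSup_le fun k => recursionPiece_le ?_ ?_ ?_ ?_
    · intro _
      simp [P.toDGA.d_one]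
    · intro _ x hx
      simp [h.d_harmonic hx]
    · intro _ x _
      simp [P.d_d]
    · intro _ x hx
      exact Submodule.mem_iSup_of_mem (k + 1) (d_dm_mem_recursionPiece hx)
  have hdm' : (⨆ k, R k) ≤ (⨆ k, R k).comap dm := by
    refine iSup_le fun k => recursionPiece_le ?_ ?_ ?_ ?_
    · intro _
      have h1 := h.dm_mem hdm P.one_mem
      rw [P.nonneg _ (by norm_num), Submodule.mem_bot] at h1
      simp [h1]
    · intro _ x hx
      simp [hdm.2.1 k x hx]
    · intro _ x hx
      rw [Submodule.mem_comap, dm_d_dm hdm (hgr k x hx)]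
      refine Submodule.mem_iSup_of_mem (k - 1) (dm_mem_recursionPiece ?_)
      rwa [sub_add_cancel]
    · intro _ x hx
      simp [dm_dm hdm (hgr _ x hx)]
  have hC : IsHSubalgebra P.toDGA H dm ((⨆ k, R k).toSubalgebra hone hmul) :=
    ⟨fun k x hx => (le_iSup R k) (h.harmonic_le_recursionPiece hsc _ k hx),
      fun a ha => hd ha, fun a ha => hdm' ha⟩
  exact fun x hx => smallAlgebra_le hC hx

theorem IsHodge.smallPiece_eq (h : P.IsHodge H B) (hsc : P.toDGA.RConnected 1)
    (hdm : P.toDGA.IsDminus H B dm) (k : ℤ) :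
    P.smallPiece H dm k = recursionPiece P.toDGA H dm (P.smallPiece H dm) k := by
  refine le_antisymm (fun x hx => ?_) (h.recursionPiece_le_smallPiece hdm k)
  exact Submodule.mem_of_mem_iSup_of_mem P.internal.submodule_iSupIndep
    (fun i => (h.recursionPiece_le_smallPiece hdm i).trans inf_le_right)
    (h.smallAlgebra_le_iSup hsc hdm hx.1) hx.2

theorem IsHodge.smallPiece_finiteDimensional (h : P.IsHodge H B) (hsc : P.toDGA.RConnected 1)
    (hdm : P.toDGA.IsDminus H B dm) (k : ℤ) : FiniteDimensional F (P.smallPiece H dm k) := by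
  have key : ∀ m : ℕ, ∀ k : ℤ, k ≤ m → FiniteDimensional F (P.smallPiece H dm k) := by
    intro m
    induction m with
    | zero =>
      intro k hk
      rw [h.smallPiece_eq hsc hdm]
      rcases eq_or_ne k 0 with rfl | h0
      · rw [recursionPiece_zero]
        infer_instance
      · rw [recursionPiece_eq_bot h0 (by push_cast at hk; omega)]
        infer_instance
    | succ m ih =>
      intro k hk
      push_cast at hk
      rcases lt_or_ge k 2 with hk2 | hk2
      · rw [h.smallPiece_eq hsc hdm]
        rcases eq_or_ne k 0 with rfl | h0
        · rw [recursionPiece_zero]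
          infer_instance
        · rw [recursionPiece_eq_bot h0 hk2]
          infer_instance
      · rw [h.smallPiece_eq hsc hdm, recursionPiece_of_two_le hk2]
        have h1 := h.harmonic_finiteDimensional k
        have h2 : FiniteDimensional F (pairSpan (P.smallPiece H dm) k) :=
          pairSpan_finiteDimensional fun l hl => ih l (by omega)
        have h3 : FiniteDimensional F (pairSpan (P.smallPiece H dm) (k + 1)) :=
          pairSpan_finiteDimensional fun l hl => ih l (by omega)
        infer_instance
  exact key k.toNat k (Int.self_le_toNat k)

theorem IsHodge.smallAlgebra_finiteDimensional (h : P.IsHodge H B)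
    (hsc : P.toDGA.RConnected 1) (hdm : P.toDGA.IsDminus H B dm) :
    FiniteDimensional F (smallAlgebra P.toDGA H dm) := by
  have hfd := h.smallPiece_finiteDimensional hsc hdm
  have hle : Subalgebra.toSubmodule (smallAlgebra P.toDGA H dm) ≤
      ⨆ k : Finset.Icc 0 n, P.smallPiece H dm k := by
    refine (h.smallAlgebra_le_iSup hsc hdm).trans (iSup_le fun k => ?_)
    refine (h.recursionPiece_le_smallPiece hdm k).trans fun x hx => ?_
    by_cases hk : k ∈ Finset.Icc 0 n
    · exact Submodule.mem_iSup_of_mem (p := fun k : Finset.Icc 0 n => P.smallPiece H dm k)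
        ⟨k, hk⟩ hx
    · have hbot : P.grading k = ⊥ := by
        rw [Finset.mem_Icc, not_and_or, not_le, not_le] at hk
        exact hk.elim (P.nonneg k) (P.top k)
      have hx0 := hx.2
      rw [SetLike.mem_coe, hbot, Submodule.mem_bot] at hx0
      simp [hx0]
  exact Submodule.finiteDimensional_of_le hle

end PoincareDGCA

/-- For a simply connected Poincaré DGCA of Hodge type, the small
algebra is given by the recursion
`A⁰_small = F·1`, `A¹_small = 0`,
`Aᵏ_small = Hᵏ ⊕ d d⁻ span{A^{l₁}·A^{l₂}, l₁,l₂ ≥ 2, l₁+l₂ = k}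
          ⊕ d⁻ span{A^{l₁}·A^{l₂}, l₁,l₂ ≥ 2, l₁+l₂ = k+1}` for `k ≥ 2`;
in particular it is finite dimensional. -/
theorem statement_4 {n : ℤ} (P : PoincareDGCA F A n)
    (hsc : P.toDGA.RConnected 1)
    (H B : ℤ → Submodule F A) (hHodge : P.IsHodge H B)
    (dm : A →ₗ[F] A) (hdm : P.toDGA.IsDminus H B dm) :
    (∃ C : ℤ → Submodule F A,
      C 0 = Submodule.span F {(1 : A)} ∧
      C 1 = ⊥ ∧
      (∀ k : ℤ, 2 ≤ k →
        C k = H k ⊔ Submodule.map (P.d ∘ₗ dm) (pairSpan C k)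
                  ⊔ Submodule.map dm (pairSpan C (k + 1))) ∧
      (∀ k : ℤ, 0 ≤ k →
        Subalgebra.toSubmodule (smallAlgebra P.toDGA H dm) ⊓ P.grading k = C k)) ∧
    FiniteDimensional F (smallAlgebra P.toDGA H dm) := by
  have hrec := hHodge.smallPiece_eq hsc hdm
  refine ⟨⟨P.smallPiece H dm, ?_, ?_, fun k hk => ?_, fun k _ => rfl⟩,
    hHodge.smallAlgebra_finiteDimensional hsc hdm⟩
  · rw [hrec, recursionPiece_zero]
  · rw [hrec, recursionPiece_eq_bot one_ne_zero one_lt_two]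
  · rw [← recursionPiece_of_two_le hk]
    exact hrec k
end
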